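/- Let G = (A ⊎ B, E) be a bipartite (2,2)-Laman graph in which every vertex has degree at least three. Then every vertex v of degree exactly three has two neighbors x, y with the property that there exists a vertex p adjacent to y and not adjacent to x such that the graph G' obtained from G by deleting v and adding the edge xp is (2,2)-Laman. -/

import Mathlib

open SimpleGraph

/-- The number of edges of the induced subgraph of `G` on a set `X` of vertices. -/
noncomputable def edgesIn {V : Type*} (G : SimpleGraph V) (X : Set V) : ℕ :=
  (G.induce X).edgeSet.ncard

/-- A finite graph `G`, with bipartition `(A, B)` of its vertex set, is `(2,2)`-Laman if
`|A|, |B| ≥ 2`, every edge joins `A` to `B`, `G` has exactly `2(|A|+|B|) - 4` edges, and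
every subgraph on at least `3` vertices has at most `2·(number of its vertices) - 4`
edges. -/
structure IsLaman22 {V : Type*} [Fintype V] (G : SimpleGraph V) (A B : Finset V) :
    Prop where
  cover : ∀ v : V, v ∈ A ∨ v ∈ B
  disj : Disjoint A B
  bip : ∀ ⦃x y⦄, G.Adj x y → (x ∈ A ∧ y ∈ B) ∨ (x ∈ B ∧ y ∈ A)
  cardA : 2 ≤ A.card
  cardB : 2 ≤ B.card
  total : G.edgeSet.ncard = 2 * (A.card + B.card) - 4
  sparse : ∀ X : Finset V, 3 ≤ X.card → edgesIn G ↑X ≤ 2 * X.card - 4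

/-- A set `X` of vertices is critical if `|X| ≥ 3` and the induced subgraph on `X` has
exactly `2|X| - 4` edges. -/
def IsCritical {V : Type*} (G : SimpleGraph V) (X : Finset V) : Prop :=
  3 ≤ X.card ∧ edgesIn G ↑X = 2 * X.card - 4

/-- The edges of `G` inside `X`, each recorded as the pair of its endpoints whose first
component lies in `T`. -/
noncomputable def orientedEdges {V : Type*} (G : SimpleGraph V) (T X : Finset V) :
    Finset (V × V) := by
  classical exact {z ∈ X ×ˢ X | z.1 ∈ T ∧ G.Adj z.1 z.2}

section Counting

variable {V : Type*} {G : SimpleGraph V} {T : Finset V}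

@[simp]
theorem mem_orientedEdges {X : Finset V} {z : V × V} :
    z ∈ orientedEdges G T X ↔ (z.1 ∈ X ∧ z.2 ∈ X) ∧ z.1 ∈ T ∧ G.Adj z.1 z.2 := by
  simp [orientedEdges]

theorem orientedEdges_mono {X Y : Finset V} (h : X ⊆ Y) :
    orientedEdges G T X ⊆ orientedEdges G T Y := by
  intro z hz
  rw [mem_orientedEdges] at hz ⊢
  exact ⟨⟨h hz.1.1, h hz.1.2⟩, hz.2⟩

theorem ncard_edgeSet_eq_ncard_oriented (S : Set V)
    (hbip : ∀ ⦃x y⦄, G.Adj x y → (x ∈ S ↔ y ∉ S)) :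
    G.edgeSet.ncard = {z : V × V | z.1 ∈ S ∧ G.Adj z.1 z.2}.ncard := by
  have himage : G.edgeSet = (fun z : V × V => s(z.1, z.2)) ''
      {z : V × V | z.1 ∈ S ∧ G.Adj z.1 z.2} := by
    ext e
    induction e using Sym2.ind with
    | _ x y =>
      simp only [SimpleGraph.mem_edgeSet, Set.mem_image, Set.mem_ofPred_eq, Prod.exists]
      constructor
      · intro h
        by_cases hx : x ∈ S
        · exact ⟨x, y, ⟨hx, h⟩, rfl⟩
        · exact ⟨y, x, ⟨(hbip h.symm).2 hx, h.symm⟩, Sym2.eq_swap⟩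
      · rintro ⟨a, b, ⟨-, h⟩, hab⟩
        rw [← SimpleGraph.mem_edgeSet, ← hab]
        exact h
  rw [himage]
  apply Set.InjOn.ncard_image
  rintro ⟨a, b⟩ ⟨ha, hab⟩ ⟨c, d⟩ ⟨hc, hcd⟩ h
  rcases Sym2.eq_iff.1 h with ⟨rfl, rfl⟩ | ⟨rfl, rfl⟩
  · rfl
  · exact absurd hc ((hbip hab).1 ha)

theorem edgesIn_eq_card_orientedEdges (hbip : ∀ ⦃x y⦄, G.Adj x y → (x ∈ T ↔ y ∉ T))
    (X : Finset V) : edgesIn G ↑X = (orientedEdges G T X).card := by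
  unfold edgesIn
  rw [ncard_edgeSet_eq_ncard_oriented {u : (X : Set V) | u.1 ∈ T}
    (fun x y h => hbip (x := x.1) (y := y.1) h)]
  rw [← Set.ncard_coe_finset, ← Set.ncard_image_of_injective _
    (Function.Injective.prodMap Subtype.val_injective Subtype.val_injective)]
  congr 1
  ext ⟨a, b⟩
  simp
  tauto

theorem ncard_edgeSet_eq_card_orientedEdges [Fintype V]
    (hbip : ∀ ⦃x y⦄, G.Adj x y → (x ∈ T ↔ y ∉ T)) :
    G.edgeSet.ncard = (orientedEdges G T Finset.univ).card := by
  rw [ncard_edgeSet_eq_ncard_oriented (T : Set V) (fun x y h => by simpa using hbip h),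
    ← Set.ncard_coe_finset]
  congr 1
  ext z
  simp

/-- Two tight sets sharing two vertices of the same colour class have a tight union. -/
theorem card_orientedEdges_union [DecidableEq V]
    (hbip : ∀ ⦃x y⦄, G.Adj x y → (x ∈ T ↔ y ∉ T))
    (hsparse : ∀ X : Finset V, 3 ≤ X.card → (orientedEdges G T X).card + 4 ≤ 2 * X.card)
    {X Y : Finset V} (hXcard : 3 ≤ X.card)
    (hX : (orientedEdges G T X).card + 4 = 2 * X.card)
    (hY : (orientedEdges G T Y).card + 4 = 2 * Y.card) {u w : V} (huw : u ≠ w)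
    (hu : u ∈ X ∩ Y) (hw : w ∈ X ∩ Y) (hside : u ∈ T ↔ w ∈ T) :
    (orientedEdges G T (X ∪ Y)).card + 4 = 2 * (X ∪ Y).card := by
  have hcard := Finset.card_union_add_card_inter X Y
  have hedge := Finset.card_union_add_card_inter (orientedEdges G T X) (orientedEdges G T Y)
  have hunion : (orientedEdges G T X ∪ orientedEdges G T Y).card ≤
      (orientedEdges G T (X ∪ Y)).card :=
    Finset.card_le_card (Finset.union_subset (orientedEdges_mono Finset.subset_union_left)
      (orientedEdges_mono Finset.subset_union_right))
  have hinter : orientedEdges G T X ∩ orientedEdges G T Y = orientedEdges G T (X ∩ Y) := by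
    ext z
    simp only [Finset.mem_inter, mem_orientedEdges]
    tauto
  have hpair : ({u, w} : Finset V) ⊆ X ∩ Y := by
    simp [Finset.insert_subset_iff, hu, hw, -Finset.mem_inter]
  have htwo : 2 ≤ (X ∩ Y).card := by
    simpa [Finset.card_pair huw] using Finset.card_le_card hpair
  have hcap : (orientedEdges G T (X ∩ Y)).card + 4 ≤ 2 * (X ∩ Y).card := by
    rcases htwo.lt_or_eq with h | h
    · exact hsparse _ h
    · have hXY : ({u, w} : Finset V) = X ∩ Y :=
        Finset.eq_of_subset_of_card_le hpair (by rw [Finset.card_pair huw, ← h])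
      have hempty : orientedEdges G T (X ∩ Y) = ∅ := by
        rw [← hXY, Finset.eq_empty_iff_forall_notMem]
        rintro ⟨s, t⟩ hst
        simp only [mem_orientedEdges, Finset.mem_insert, Finset.mem_singleton] at hst
        obtain ⟨⟨rfl | rfl, rfl | rfl⟩, hs, hadj⟩ := hst
        · exact hadj.ne rfl
        · exact (hbip hadj).1 hs (hside.1 hs)
        · exact (hbip hadj).1 hs (hside.2 hs)
        · exact hadj.ne rfl
      rw [hempty, ← h]
      simp
  have hle := hsparse (X ∪ Y) (hXcard.trans (Finset.card_le_card Finset.subset_union_left))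
  rw [hinter] at hedge
  omega

/-- In a tight set, every vertex has a neighbour. -/
theorem exists_adj_of_card_orientedEdges [DecidableEq V]
    (hbip : ∀ ⦃x y⦄, G.Adj x y → (x ∈ T ↔ y ∉ T))
    (hsparse : ∀ X : Finset V, 3 ≤ X.card → (orientedEdges G T X).card + 4 ≤ 2 * X.card)
    {X : Finset V} (hXcard : 3 ≤ X.card)
    (hX : (orientedEdges G T X).card + 4 = 2 * X.card) {x : V} (hx : x ∈ X) :
    ∃ w ∈ X, G.Adj x w := by
  by_contra! hno
  have hsub : orientedEdges G T X ⊆ orientedEdges G T (X.erase x) := by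
    rintro ⟨s, t⟩ hst
    simp only [mem_orientedEdges, Finset.mem_erase] at hst ⊢
    refine ⟨⟨⟨?_, hst.1.1⟩, ?_, hst.1.2⟩, hst.2⟩
    · rintro rfl
      exact hno t hst.1.2 hst.2.2
    · rintro rfl
      exact hno s hst.1.1 hst.2.2.symm
  have hle := Finset.card_le_card hsub
  have herase := Finset.card_erase_of_mem hx
  rcases hXcard.lt_or_eq with h | h
  · have := hsparse (X.erase x) (by omega)
    omega
  · obtain ⟨s, t, hst, hpair⟩ := Finset.card_eq_two.1 (show (X.erase x).card = 2 by omega)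
    obtain ⟨⟨a, b⟩, ha, ⟨c, d⟩, hc, hne⟩ := Finset.one_lt_card.1
      (show 1 < (orientedEdges G T (X.erase x)).card by omega)
    rw [hpair] at ha hc
    simp only [mem_orientedEdges, Finset.mem_insert, Finset.mem_singleton] at ha hc
    have h₁ := hbip ha.2.2
    have h₂ := hbip hc.2.2
    grind

theorem sum_card_le_card_biUnion_of_card_inter_le_one {ι α : Type*} [DecidableEq ι]
    [DecidableEq α] (s : Finset ι) (f : ι → Finset α) (hs : 1 ≤ s.card) (hs' : s.card ≤ 3)
    (hf : ∀ i ∈ s, ∀ j ∈ s, i ≠ j → (f i ∩ f j).card ≤ 1) :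
    ∑ i ∈ s, (f i).card + 2 ≤ (s.biUnion f).card + 2 * s.card := by
  have hcases : s.card = 1 ∨ s.card = 2 ∨ s.card = 3 := by omega
  rcases hcases with h | h | h
  · obtain ⟨i, rfl⟩ := Finset.card_eq_one.1 h
    simp
  · obtain ⟨i, j, hij, rfl⟩ := Finset.card_eq_two.1 h
    have h₁ := hf i (by simp) j (by simp) hij
    have h₂ := Finset.card_union_add_card_inter (f i) (f j)
    simp only [Finset.sum_pair hij, Finset.biUnion_insert, Finset.singleton_biUnion, h]
    omega
  · obtain ⟨i, j, k, hij, hik, hjk, rfl⟩ := Finset.card_eq_three.1 h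
    have h₁ := hf i (by simp) j (by simp) hij
    have h₂ := hf i (by simp) k (by simp) hik
    have h₃ := hf j (by simp) k (by simp) hjk
    have h₄ := Finset.card_union_add_card_inter (f j) (f k)
    have h₅ := Finset.card_union_add_card_inter (f i) (f j ∪ f k)
    have h₆ : (f i ∩ (f j ∪ f k)).card ≤ (f i ∩ f j).card + (f i ∩ f k).card := by
      rw [Finset.inter_union_distrib_left]
      exact Finset.card_union_le _ _
    rw [Finset.sum_insert (by simp [hij, hik]), Finset.sum_pair hjk, Finset.biUnion_insert,
      Finset.biUnion_insert, Finset.singleton_biUnion, h]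
    omega

/-- If tight sets, any two of which share at most one vertex of each colour class, cover all
nonadjacent pairs of `N ×ˢ P`, then their union with `N` and `P` spans many edges. -/
theorem two_mul_card_add_card_le_card_orientedEdges [DecidableEq V] (N P : Finset V)
    (F : Finset (Finset V)) (hN : N ⊆ T) (hP : Disjoint P T) (hNcard : N.card = 3)
    (hbip : ∀ ⦃x y⦄, G.Adj x y → (x ∈ T ↔ y ∉ T))
    (htight : ∀ X ∈ F, (orientedEdges G T X).card + 4 = 2 * X.card)
    (hmeet : ∀ X ∈ F, ((X ∩ N).card = 1 ∧ 2 ≤ (X ∩ P).card) ∨ (X ∩ N).card = 2)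
    (hcover : ∀ x ∈ N, ∀ p ∈ P, ¬ G.Adj x p → ∃ X ∈ F, x ∈ X ∧ p ∈ X)
    (hlinear : ∀ X ∈ F, ∀ Y ∈ F, X ≠ Y → ∀ u ∈ X ∩ Y, ∀ w ∈ X ∩ Y, (u ∈ T ↔ w ∈ T) → u = w)
    (hclosed : ∀ X ∈ F, ∀ x ∈ N, ∀ w ∈ X, G.Adj x w → w ∈ P) :
    2 * (N ∪ P ∪ F.biUnion id).card + P.card ≤
      (orientedEdges G T (N ∪ P ∪ F.biUnion id)).card + 6 := by
  classical
  set U := N ∪ P ∪ F.biUnion id with hU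
  have hFU : ∀ X ∈ F, X ⊆ U := fun X hX =>
    (Finset.subset_biUnion_of_mem id hX).trans Finset.subset_union_right
  have hPT : ∀ p ∈ P, p ∉ T := fun p hp => Finset.disjoint_left.1 hP hp
  set Q := U.filter (fun u => u ∈ T ∧ u ∉ N) with hQ
  set W := U.filter (fun u => u ∉ T ∧ u ∉ P) with hW
  -- the partition of a subset of `U` into the four parts
  have hsplit : ∀ X ⊆ U, X.card = (X ∩ N).card + (X ∩ P).card + (X ∩ Q).card +
      (X ∩ W).card := by
    intro X hXU
    have h₁ := Finset.card_filter_add_card_filter_not (s := X) (fun u => u ∈ T)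
    have h₂ := Finset.card_filter_add_card_filter_not (s := X.filter (fun u => u ∈ T))
      (fun u => u ∈ N)
    have h₃ := Finset.card_filter_add_card_filter_not (s := X.filter (fun u => u ∉ T))
      (fun u => u ∈ P)
    have e₁ : (X.filter (fun u => u ∈ T)).filter (fun u => u ∈ N) = X ∩ N := by
      ext u
      simp only [Finset.mem_filter, Finset.mem_inter]
      exact ⟨fun h => ⟨h.1.1, h.2⟩, fun h => ⟨⟨h.1, hN h.2⟩, h.2⟩⟩
    have e₂ : (X.filter (fun u => u ∉ T)).filter (fun u => u ∈ P) = X ∩ P := by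
      ext u
      simp only [Finset.mem_filter, Finset.mem_inter]
      exact ⟨fun h => ⟨h.1.1, h.2⟩, fun h => ⟨⟨h.1, hPT u h.2⟩, h.2⟩⟩
    have e₃ : (X.filter (fun u => u ∈ T)).filter (fun u => u ∉ N) = X ∩ Q := by
      ext u
      simp only [Finset.mem_filter, Finset.mem_inter, hQ]
      exact ⟨fun h => ⟨h.1.1, hXU h.1.1, h.1.2, h.2⟩, fun h => ⟨⟨h.1, h.2.2.1⟩, h.2.2.2⟩⟩
    have e₄ : (X.filter (fun u => u ∉ T)).filter (fun u => u ∉ P) = X ∩ W := by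
      ext u
      simp only [Finset.mem_filter, Finset.mem_inter, hW]
      exact ⟨fun h => ⟨h.1.1, hXU h.1.1, h.1.2, h.2⟩, fun h => ⟨⟨h.1, h.2.2.1⟩, h.2.2.2⟩⟩
    rw [e₁, e₃] at h₂
    rw [e₂, e₄] at h₃
    omega
  let nb : V → Finset V → Finset V := fun q X => X.filter (fun w => G.Adj q w)
  -- edges spanned by `X`, split by whether they meet `N`
  have hedges : ∀ X ⊆ U, (∀ x ∈ N, ∀ w ∈ X, x ∈ X → G.Adj x w → w ∈ P) →
      (orientedEdges G T X).card = (((X ∩ N) ×ˢ (X ∩ P)).filter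
        (fun z => G.Adj z.1 z.2)).card + ∑ q ∈ X ∩ Q, (nb q X).card := by
    intro X hXU hcl
    rw [← Finset.card_filter_add_card_filter_not (s := orientedEdges G T X)
      (fun z => z.1 ∈ N)]
    congr 1
    · congr 1
      ext ⟨s, t⟩
      simp only [Finset.mem_filter, mem_orientedEdges, Finset.mem_product, Finset.mem_inter]
      constructor
      · rintro ⟨⟨⟨hs, ht⟩, -, hst⟩, hsN⟩
        exact ⟨⟨⟨hs, hsN⟩, ht, hcl s hsN t ht hs hst⟩, hst⟩
      · rintro ⟨⟨⟨hs, hsN⟩, ht, -⟩, hst⟩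
        exact ⟨⟨⟨hs, ht⟩, hN hsN, hst⟩, hsN⟩
    · rw [← Finset.card_sigma]
      refine Finset.card_bij' (fun z _ => ⟨z.1, z.2⟩) (fun z _ => (z.1, z.2)) ?_ ?_
        (fun _ _ => rfl) (fun _ _ => rfl)
      · rintro ⟨s, t⟩ h
        simp only [Finset.mem_filter, mem_orientedEdges] at h
        simp only [Finset.mem_sigma, Finset.mem_inter, hQ, Finset.mem_filter, nb]
        exact ⟨⟨h.1.1.1, hXU h.1.1.1, h.1.2.1, h.2⟩, h.1.1.2, h.1.2.2⟩
      · rintro ⟨s, t⟩ h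
        simp only [Finset.mem_sigma, Finset.mem_inter, hQ, Finset.mem_filter, nb] at h
        simp only [Finset.mem_filter, mem_orientedEdges]
        exact ⟨⟨⟨h.1.1, h.2.1⟩, h.1.2.2.1, h.2.2⟩, h.1.2.2.2⟩
  have hbody : ∀ X ∈ F, (((X ∩ N) ×ˢ (X ∩ P)).filter (fun z => ¬ G.Adj z.1 z.2)).card +
      2 * (X ∩ Q).card + 2 * (X ∩ W).card ≤ ∑ q ∈ X ∩ Q, (nb q X).card := by
    intro X hX
    have h₁ := htight X hX
    have h₂ := hsplit X (hFU X hX)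
    have h₃ := hedges X (hFU X hX) (fun x hx w hw _ h => hclosed X hX x hx w hw h)
    have h₄ := Finset.card_filter_add_card_filter_not (s := (X ∩ N) ×ˢ (X ∩ P))
      (fun z => G.Adj z.1 z.2)
    rw [Finset.card_product] at h₄
    rcases hmeet X hX with ⟨h₅, h₆⟩ | h₅
    · rw [h₅] at h₄ h₂
      omega
    · rw [h₅] at h₄ h₂
      omega
  have hsum := Finset.sum_le_sum hbody
  rw [Finset.sum_add_distrib, Finset.sum_add_distrib, ← Finset.mul_sum, ← Finset.mul_sum]
    at hsum
  have hswap : ∀ (R : Finset V) (g : V → Finset V → ℕ),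
      ∑ X ∈ F, ∑ q ∈ X ∩ R, g q X = ∑ q ∈ R, ∑ X ∈ F with q ∈ X, g q X := by
    intro R g
    refine Finset.sum_comm' ?_
    intro X q
    simp only [Finset.mem_inter, Finset.mem_filter]
    tauto
  have hswapcard : ∀ R : Finset V,
      ∑ X ∈ F, (X ∩ R).card = ∑ q ∈ R, (F.filter (fun X => q ∈ X)).card := by
    intro R
    simp only [Finset.card_eq_sum_ones]
    exact hswap R (fun _ _ => 1)
  have hmemF : ∀ q ∈ U, q ∉ N → q ∉ P → 1 ≤ (F.filter (fun X => q ∈ X)).card := by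
    intro q hq hqN hqP
    have : ∃ X ∈ F, q ∈ X := by simpa [hU, hqN, hqP] using hq
    obtain ⟨X, hX, hqX⟩ := this
    exact Finset.card_pos.2 ⟨X, Finset.mem_filter.2 ⟨hX, hqX⟩⟩
  have hWsum : W.card ≤ ∑ X ∈ F, (X ∩ W).card := by
    rw [hswapcard, Finset.card_eq_sum_ones]
    refine Finset.sum_le_sum fun q hq => ?_
    simp only [hW, Finset.mem_filter] at hq
    exact hmemF q hq.1 (fun h => hq.2.1 (hN h)) hq.2.2
  have hlocal : ∀ q ∈ Q, ∑ X ∈ F with q ∈ X, (nb q X).card + 2 ≤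
      (nb q U).card + 2 * (F.filter (fun X => q ∈ X)).card := by
    intro q hq
    simp only [hQ, Finset.mem_filter] at hq
    have hthree : (F.filter (fun X => q ∈ X)).card ≤ 3 := by
      rw [← hNcard]
      have hex : ∀ X ∈ F, ∃ x, x ∈ X ∩ N := by
        intro X hX
        have := hmeet X hX
        exact Finset.card_pos.1 (by omega)
      have : Nonempty V := ⟨q⟩
      choose! c hc using hex
      refine Finset.card_le_card_of_injOn c ?_ ?_
      · intro X hX
        exact (Finset.mem_inter.1 (hc X (Finset.mem_filter.1 hX).1)).2
      · intro X hX Y hY hXY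
        have hX := Finset.mem_filter.1 hX
        have hY := Finset.mem_filter.1 hY
        have hcX := Finset.mem_inter.1 (hc X hX.1)
        have hcY := Finset.mem_inter.1 (hc Y hY.1)
        by_contra hne
        have hqc := hlinear X hX.1 Y hY.1 hne q (Finset.mem_inter.2 ⟨hX.2, hY.2⟩) (c X)
          (Finset.mem_inter.2 ⟨hcX.1, hXY ▸ hcY.1⟩)
          (iff_of_true hq.2.1 (hN hcX.2))
        exact hq.2.2 (hqc ▸ hcX.2)
    have hstar := sum_card_le_card_biUnion_of_card_inter_le_one
      (F.filter (fun X => q ∈ X)) (nb q) (hmemF q hq.1 hq.2.2 (fun h => hPT q h hq.2.1))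
      hthree (by
        intro X hX Y hY hne
        rw [Finset.mem_filter] at hX hY
        rw [Finset.card_le_one]
        intro s hs t ht
        simp only [nb, Finset.mem_inter, Finset.mem_filter] at hs ht
        exact hlinear X hX.1 Y hY.1 hne s (Finset.mem_inter.2 ⟨hs.1.1, hs.2.1⟩) t
          (Finset.mem_inter.2 ⟨ht.1.1, ht.2.1⟩)
          (iff_of_false ((hbip hs.1.2).1 hq.2.1) ((hbip ht.1.2).1 hq.2.1)))
    have hsub : (F.filter (fun X => q ∈ X)).biUnion (nb q) ⊆ nb q U := by
      refine Finset.biUnion_subset.2 fun X hX => ?_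
      exact Finset.filter_subset_filter _ (hFU X (Finset.mem_filter.1 hX).1)
    have := Finset.card_le_card hsub
    omega
  have hlocalsum := Finset.sum_le_sum hlocal
  rw [Finset.sum_add_distrib, Finset.sum_add_distrib, ← Finset.mul_sum, Finset.sum_const,
    ← hswapcard, ← hswap Q (fun q X => (nb q X).card), smul_eq_mul] at hlocalsum
  have hnonadj : ((N ×ˢ P).filter (fun z => ¬ G.Adj z.1 z.2)).card ≤
      ∑ X ∈ F, (((X ∩ N) ×ˢ (X ∩ P)).filter (fun z => ¬ G.Adj z.1 z.2)).card := by
    refine le_trans (Finset.card_le_card ?_) Finset.card_biUnion_le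
    rintro ⟨x, p⟩ h
    simp only [Finset.mem_filter, Finset.mem_product] at h
    obtain ⟨X, hX, hx, hp⟩ := hcover x h.1.1 p h.1.2 h.2
    simp only [Finset.mem_biUnion, Finset.mem_filter, Finset.mem_product, Finset.mem_inter]
    exact ⟨X, hX, ⟨⟨hx, h.1.1⟩, hp, h.1.2⟩, h.2⟩
  have hNU : U ∩ N = N := Finset.inter_eq_right.2
    (Finset.subset_union_left.trans Finset.subset_union_left)
  have hPU : U ∩ P = P := Finset.inter_eq_right.2
    (Finset.subset_union_right.trans Finset.subset_union_left)
  have hQU : U ∩ Q = Q := Finset.inter_eq_right.2 (Finset.filter_subset _ _)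
  have hWU : U ∩ W = W := Finset.inter_eq_right.2 (Finset.filter_subset _ _)
  have hcardU := hsplit U subset_rfl
  have hedgesU : ((N ×ˢ P).filter (fun z => G.Adj z.1 z.2)).card + ∑ q ∈ Q, (nb q U).card ≤
      (orientedEdges G T U).card := by
    have h := hedges U subset_rfl (by
      intro x hx w hw _ hxw
      simp only [hU, Finset.mem_union, Finset.mem_biUnion, id_eq] at hw
      rcases hw with (hw | hw) | ⟨X, hX, hw⟩
      · exact absurd (hN hw) ((hbip hxw).1 (hN hx))
      · exact hw
      · exact hclosed X hX x hx w hw hxw)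
    rw [hNU, hPU, hQU] at h
    exact h.ge
  have hprod := Finset.card_filter_add_card_filter_not (s := N ×ˢ P)
    (fun z => G.Adj z.1 z.2)
  rw [Finset.card_product, hNcard] at hprod
  rw [hNU, hPU, hQU, hWU, hNcard] at hcardU
  omega

end Counting

section Laman

variable {V : Type*} [Fintype V] {G : SimpleGraph V} {A B : Finset V}

theorem IsLaman22.swap (h : IsLaman22 G A B) : IsLaman22 G B A where
  cover u := (h.cover u).symm
  disj := h.disj.symm
  bip _ _ hxy := (h.bip hxy).symm
  cardA := h.cardB
  cardB := h.cardA
  total := by rw [h.total, Nat.add_comm]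
  sparse := h.sparse

theorem IsLaman22.mem_iff_notMem (h : IsLaman22 G A B) ⦃x y : V⦄ (hxy : G.Adj x y) :
    x ∈ B ↔ y ∉ B := by
  have hd : ∀ u, u ∈ A → u ∉ B := fun _ hu => Finset.disjoint_left.1 h.disj hu
  have := h.bip hxy
  have := hd x
  have := hd y
  tauto

theorem IsLaman22.card_orientedEdges_add_four_le (h : IsLaman22 G A B) (X : Finset V)
    (hX : 3 ≤ X.card) : (orientedEdges G B X).card + 4 ≤ 2 * X.card := by
  have := h.sparse X hX
  rw [edgesIn_eq_card_orientedEdges h.mem_iff_notMem] at this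
  omega

variable [DecidableEq V] [DecidableRel G.Adj]

theorem card_orientedEdges_add_card_le_insert
    (hbip : ∀ ⦃x y⦄, G.Adj x y → (x ∈ B ↔ y ∉ B)) {v : V} (hv : v ∉ B) {U : Finset V}
    (hvU : v ∉ U) (hN : G.neighborFinset v ⊆ U) :
    (orientedEdges G B U).card + G.degree v ≤ (orientedEdges G B (insert v U)).card := by
  have hcard : ((G.neighborFinset v).image fun x => (x, v)).card = G.degree v := by
    rw [Finset.card_image_of_injective _ (Prod.mk_left_injective v),
      SimpleGraph.card_neighborFinset_eq_degree]
  rw [← hcard, ← Finset.card_union_of_disjoint]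
  · refine Finset.card_le_card (Finset.union_subset
      (orientedEdges_mono (Finset.subset_insert _ _)) ?_)
    intro z hz
    obtain ⟨x, hx, rfl⟩ := Finset.mem_image.1 hz
    have hadj := (G.mem_neighborFinset v x).1 hx
    simp only [mem_orientedEdges, Finset.mem_insert]
    exact ⟨⟨Or.inr (hN hx), Or.inl trivial⟩, (hbip hadj.symm).2 hv, hadj.symm⟩
  · rw [Finset.disjoint_left]
    intro z hz hz'
    obtain ⟨x, hx, rfl⟩ := Finset.mem_image.1 hz'
    exact hvU (mem_orientedEdges.1 hz).1.2

/-- Deleting a vertex `v` of degree three and adding the edge `xp` preserves the Laman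
property unless some tight set avoiding `v` contains both `x` and `p`. -/
theorem IsLaman22.delete_add_edge (h : IsLaman22 G A B) (hmin : ∀ u : V, 3 ≤ G.degree u)
    {v x p : V} (hv : G.degree v = 3) (hvA : v ∈ A) (hx : x ∈ B) (hp : p ∈ A) (hpv : p ≠ v)
    (hxp : ¬ G.Adj x p)
    (hfree : ∀ X : Finset V, v ∉ X → x ∈ X → p ∈ X → 3 ≤ X.card →
      (orientedEdges G B X).card + 4 ≠ 2 * X.card) :
    IsLaman22 ((G ⊔ SimpleGraph.fromEdgeSet {s(x, p)}).comap
      (Subtype.val : {u : V // u ≠ v} → V)) (A.subtype (· ≠ v)) (B.subtype (· ≠ v)) := by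
  have hdisj : ∀ u, u ∈ A → u ∉ B := fun _ hu => Finset.disjoint_left.1 h.disj hu
  have hvB : v ∉ B := hdisj v hvA
  have hxv : x ≠ v := fun e => hvB (e ▸ hx)
  have hpB : p ∉ B := hdisj p hp
  have hxnp : x ≠ p := fun e => hpB (e ▸ hx)
  set G' := (G ⊔ SimpleGraph.fromEdgeSet {s(x, p)}).comap
    (Subtype.val : {u : V // u ≠ v} → V) with hG'
  have hadj : ∀ s t : {u : V // u ≠ v}, G'.Adj s t ↔
      G.Adj s.1 t.1 ∨ (s.1 = x ∧ t.1 = p) ∨ (s.1 = p ∧ t.1 = x) := by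
    intro s t
    simp only [hG', SimpleGraph.comap_adj, SimpleGraph.sup_adj, SimpleGraph.fromEdgeSet_adj,
      Set.mem_singleton_iff, Sym2.eq_iff]
    grind
  have hbip' : ∀ ⦃s t⦄, G'.Adj s t →
      (s ∈ B.subtype (· ≠ v) ↔ t ∉ B.subtype (· ≠ v)) := by
    intro s t hst
    simp only [Finset.mem_subtype]
    rcases (hadj s t).1 hst with hst | ⟨hs, ht⟩ | ⟨hs, ht⟩
    · exact h.mem_iff_notMem hst
    · rw [hs, ht]; tauto
    · rw [hs, ht]; tauto
  have hmap : ∀ X : Finset {u : V // u ≠ v},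
      (orientedEdges G' (B.subtype (· ≠ v)) X).map
        ((Function.Embedding.subtype _).prodMap (Function.Embedding.subtype _)) =
      orientedEdges G B (X.map (Function.Embedding.subtype _)) ∪
        (({(x, p)} : Finset (V × V)).filter fun z =>
          z.1 ∈ X.map (Function.Embedding.subtype _) ∧
            z.2 ∈ X.map (Function.Embedding.subtype _)) := by
    intro X
    ext ⟨s, t⟩
    simp [hadj]
    grind
  have hcardA : (A.subtype (· ≠ v)).card + 1 = A.card := by
    rw [Finset.card_subtype, Finset.filter_ne', Finset.card_erase_add_one hvA]
  have hcardB : (B.subtype (· ≠ v)).card = B.card := by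
    rw [Finset.card_subtype, Finset.filter_ne', Finset.erase_eq_of_notMem hvB]
  have hthreeB : 3 ≤ B.card := by
    rw [← hv, ← SimpleGraph.card_neighborFinset_eq_degree]
    refine Finset.card_le_card fun w hw => ?_
    rw [SimpleGraph.mem_neighborFinset] at hw
    exact (h.mem_iff_notMem hw.symm).2 hvB
  have hthreeA : 3 ≤ A.card := by
    refine (hmin x).trans ?_
    rw [← SimpleGraph.card_neighborFinset_eq_degree]
    refine Finset.card_le_card fun w hw => ?_
    rw [SimpleGraph.mem_neighborFinset] at hw
    exact (h.cover w).resolve_right ((h.mem_iff_notMem hw).1 hx)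
  refine ⟨?_, ?_, ?_, by omega, by omega, ?_, ?_⟩
  · intro u
    simpa using h.cover u
  · rw [Finset.disjoint_left]
    intro u hu
    simpa using hdisj u (by simpa using hu)
  · intro s t hst
    have hb := hbip' hst
    have hs := h.cover s
    have ht := h.cover t
    have hs' := hdisj s
    have ht' := hdisj t
    simp only [Finset.mem_subtype] at hb ⊢
    tauto
  · have htotal := h.total
    rw [ncard_edgeSet_eq_card_orientedEdges h.mem_iff_notMem] at htotal
    rw [ncard_edgeSet_eq_card_orientedEdges hbip']
    have huniv : (Finset.univ : Finset {u : V // u ≠ v}).map (Function.Embedding.subtype _) =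
        Finset.univ.erase v := by
      ext u
      simp
    have hcard := congrArg Finset.card (hmap Finset.univ)
    rw [Finset.card_map, huniv, Finset.filter_true_of_mem (by simp [hxv, hpv]),
      Finset.card_union_of_disjoint (by simp [hxp]), Finset.card_singleton] at hcard
    have hins : (orientedEdges G B Finset.univ).card =
        (orientedEdges G B (Finset.univ.erase v)).card + G.degree v := by
      have hle := card_orientedEdges_add_card_le_insert h.mem_iff_notMem hvB
        (Finset.notMem_erase v Finset.univ) (fun w hw => by
          rw [SimpleGraph.mem_neighborFinset] at hw
          simpa using hw.ne')
      rw [Finset.insert_erase (Finset.mem_univ v)] at hle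
      refine le_antisymm ?_ hle
      have hsub : orientedEdges G B Finset.univ ⊆ orientedEdges G B (Finset.univ.erase v) ∪
          (G.neighborFinset v).image fun x => (x, v) := by
        rintro ⟨s, t⟩ hst
        simp only [mem_orientedEdges, Finset.mem_union, Finset.mem_erase, Finset.mem_image,
          SimpleGraph.mem_neighborFinset, Finset.mem_univ, and_true, true_and] at hst ⊢
        by_cases ht : t = v
        · subst ht
          exact Or.inr ⟨s, hst.2.symm, rfl⟩
        · exact Or.inl ⟨⟨fun e => hvB (e ▸ hst.1), ht⟩, hst⟩
      refine (Finset.card_le_card hsub).trans ((Finset.card_union_le _ _).trans ?_)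
      exact Nat.add_le_add_left (Finset.card_image_le.trans_eq
        (SimpleGraph.card_neighborFinset_eq_degree G v)) _
    omega
  · intro X hX
    rw [edgesIn_eq_card_orientedEdges hbip']
    have hcard := congrArg Finset.card (hmap X)
    rw [Finset.card_map] at hcard
    have hXcard : (X.map (Function.Embedding.subtype _)).card = X.card := Finset.card_map _
    have hsp := h.card_orientedEdges_add_four_le (X.map (Function.Embedding.subtype _))
      (by omega)
    by_cases hxpX : x ∈ X.map (Function.Embedding.subtype _) ∧
        p ∈ X.map (Function.Embedding.subtype _)
    · have hne := hfree (X.map (Function.Embedding.subtype _)) (by simp) hxpX.1 hxpX.2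
        (by omega)
      have hle := (hcard.trans_le (Finset.card_union_le _ _)).trans (Nat.add_le_add_left
        ((Finset.card_filter_le _ _).trans_eq (Finset.card_singleton _)) _)
      omega
    · rw [Finset.filter_false_of_mem (by simpa using hxpX), Finset.union_empty] at hcard
      omega

theorem IsLaman22.exists_delete_add_edge (hL : IsLaman22 G A B)
    (hmin : ∀ u : V, 3 ≤ G.degree u) {v : V} (hv : G.degree v = 3) (hvA : v ∈ A) :
    ∃ x y : V, G.Adj v x ∧ G.Adj v y ∧ x ≠ y ∧
      ∃ p : V, p ≠ v ∧ G.Adj y p ∧ ¬ G.Adj x p ∧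
        IsLaman22
          ((G ⊔ SimpleGraph.fromEdgeSet {s(x, p)}).comap
            (Subtype.val : {u : V // u ≠ v} → V))
          (A.subtype (· ≠ v)) (B.subtype (· ≠ v)) := by
  classical
  by_contra! hcon
  have hbip := hL.mem_iff_notMem
  have hsparse := hL.card_orientedEdges_add_four_le
  have hvB : v ∉ B := Finset.disjoint_left.1 hL.disj hvA
  set N := G.neighborFinset v with hN
  have hNcard : N.card = 3 := by rw [hN, SimpleGraph.card_neighborFinset_eq_degree, hv]
  have hNadj : ∀ x, x ∈ N ↔ G.Adj v x := fun x => G.mem_neighborFinset v x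
  have hNB : N ⊆ B := fun x hx => (hbip ((hNadj x).1 hx).symm).2 hvB
  set P := (N.biUnion fun x => G.neighborFinset x).erase v with hP
  have hPmem : ∀ p, p ∈ P ↔ p ≠ v ∧ ∃ y ∈ N, G.Adj y p := by
    intro p
    simp [hP]
  have hPB : Disjoint P B := by
    rw [Finset.disjoint_left]
    intro p hp
    obtain ⟨-, y, hy, hyp⟩ := (hPmem p).1 hp
    exact (hbip hyp).1 (hNB hy)
  have hPcard : 2 ≤ P.card := by
    obtain ⟨y, hy⟩ : N.Nonempty := Finset.card_pos.1 (by omega)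
    have hsub : (G.neighborFinset y).erase v ⊆ P :=
      Finset.erase_subset_erase v (Finset.subset_biUnion_of_mem (fun x => G.neighborFinset x) hy)
    have h₁ := Finset.card_le_card hsub
    have h₂ := Finset.pred_card_le_card_erase (s := G.neighborFinset y) (a := v)
    have h₃ := hmin y
    rw [SimpleGraph.card_neighborFinset_eq_degree] at h₂
    omega
  have hsparse' : ∀ U : Finset V, v ∉ U → N ⊆ U →
      (orientedEdges G B U).card + 5 ≤ 2 * U.card := by
    intro U hvU hNU
    have h₁ := card_orientedEdges_add_card_le_insert hbip hvB hvU hNU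
    have h₂ := Finset.card_le_card hNU
    have h₃ := Finset.card_insert_of_notMem hvU
    have h₄ := hsparse (insert v U) (by omega)
    omega
  let tight : Finset V → Prop := fun X =>
    v ∉ X ∧ 3 ≤ X.card ∧ (orientedEdges G B X).card + 4 = 2 * X.card
  let F : Finset (Finset V) := Finset.univ.filter fun X =>
    Maximal tight X ∧ (X ∩ N).Nonempty ∧ 2 ≤ (X ∩ P).card
  have hFmem : ∀ X, X ∈ F ↔ Maximal tight X ∧ (X ∩ N).Nonempty ∧ 2 ≤ (X ∩ P).card := by
    simp [F]
  have hclosed : ∀ X, tight X → ∀ x ∈ N, ∀ w ∈ X, G.Adj x w → w ∈ P := by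
    intro X hX x hx w hw hxw
    exact (hPmem w).2 ⟨fun e => hX.1 (e ▸ hw), x, hx, hxw⟩
  have hcover : ∀ x ∈ N, ∀ p ∈ P, ¬ G.Adj x p → ∃ X ∈ F, x ∈ X ∧ p ∈ X := by
    intro x hx p hp hxp
    obtain ⟨hpv, y, hy, hyp⟩ := (hPmem p).1 hp
    have hnot := hcon x y ((hNadj x).1 hx) ((hNadj y).1 hy) (fun e => hxp (e ▸ hyp)) p hpv
      hyp hxp
    have htight : ∃ X, tight X ∧ x ∈ X ∧ p ∈ X := by
      by_contra! hno
      refine hnot (hL.delete_add_edge hmin hv hvA (hNB hx) ?_ hpv hxp ?_)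
      · exact (hL.cover p).resolve_right (Finset.disjoint_left.1 hPB hp)
      · intro X hvX hxX hpX hX hcrit
        exact hno X ⟨hvX, hX, hcrit⟩ hxX hpX
    obtain ⟨X, hX, hxX, hpX⟩ := htight
    obtain ⟨Y, hXY, hY⟩ := Finite.exists_le_maximal hX
    obtain ⟨w, hw, hxw⟩ := exists_adj_of_card_orientedEdges hbip hsparse hX.2.1 hX.2.2 hxX
    refine ⟨Y, (hFmem Y).2 ⟨hY, ⟨x, Finset.mem_inter.2 ⟨hXY hxX, hx⟩⟩, ?_⟩, hXY hxX, hXY hpX⟩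
    refine Finset.one_lt_card.2 ⟨w, Finset.mem_inter.2 ⟨hXY hw, hclosed X hX x hx w hw hxw⟩, p,
      Finset.mem_inter.2 ⟨hXY hpX, hp⟩, ?_⟩
    rintro rfl
    exact hxp hxw
  have hcount := two_mul_card_add_card_le_card_orientedEdges N P F hNB hPB hNcard hbip
    (fun X hX => ((hFmem X).1 hX).1.prop.2.2) (fun X hX => by
      obtain ⟨hmax, hne, htwo⟩ := (hFmem X).1 hX
      have h₁ := Finset.card_pos.2 hne
      have h₂ : (X ∩ N).card < 3 := by
        by_contra! hge
        have hNX : X ∩ N = N :=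
          Finset.eq_of_subset_of_card_le Finset.inter_subset_right (by omega)
        have := hsparse' X hmax.prop.1 (Finset.inter_eq_right.1 hNX)
        have := hmax.prop.2.2
        omega
      omega) hcover (fun X hX Y hY hne u hu w hw hside => by
      by_contra huw
      have hX := ((hFmem X).1 hX).1
      have hY := ((hFmem Y).1 hY).1
      have hunion : tight (X ∪ Y) :=
        ⟨by simp [hX.prop.1, hY.prop.1],
          hX.prop.2.1.trans (Finset.card_le_card Finset.subset_union_left),
          card_orientedEdges_union hbip hsparse hX.prop.2.1 hX.prop.2.2 hY.prop.2.2 huw hu hw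
            hside⟩
      exact hne ((hX.eq_of_le hunion Finset.subset_union_left).trans
        (hY.eq_of_le hunion Finset.subset_union_right).symm))
    (fun X hX => hclosed X ((hFmem X).1 hX).1.prop)
  have hfinal := hsparse' (N ∪ P ∪ F.biUnion id)
    (by
      simp only [Finset.mem_union, Finset.mem_biUnion, id_eq]
      rintro ((h | h) | ⟨X, hX, h⟩)
      · exact ((hNadj v).1 h).ne rfl
      · exact ((hPmem v).1 h).1 rfl
      · exact ((hFmem X).1 hX).1.prop.1 h)
    (Finset.subset_union_left.trans Finset.subset_union_left)
  omega

end Laman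

/-- Let `G` be a bipartite `(2,2)`-Laman graph in which every vertex has
degree at least three. Then every vertex `v` of degree exactly three has two neighbors
`x, y` such that there is a vertex `p` adjacent to `y` and not adjacent to `x` for which
the graph `G'` obtained from `G` by deleting `v` and adding the edge `xp` is
`(2,2)`-Laman. -/
theorem laman_recursive_step {V : Type*} [Fintype V] [DecidableEq V]
    (G : SimpleGraph V) [DecidableRel G.Adj] (A B : Finset V) (hL : IsLaman22 G A B)
    (hmin : ∀ u : V, 3 ≤ G.degree u) (v : V) (hv : G.degree v = 3) :
    ∃ x y : V, G.Adj v x ∧ G.Adj v y ∧ x ≠ y ∧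
      ∃ p : V, p ≠ v ∧ G.Adj y p ∧ ¬ G.Adj x p ∧
        IsLaman22
          ((G ⊔ SimpleGraph.fromEdgeSet {s(x, p)}).comap
            (Subtype.val : {u : V // u ≠ v} → V))
          (A.subtype (· ≠ v)) (B.subtype (· ≠ v)) := by
  rcases hL.cover v with hvA | hvB
  · exact hL.exists_delete_add_edge hmin hv hvA
  · obtain ⟨x, y, hx, hy, hxy, p, hpv, hyp, hxp, hlam⟩ :=
      hL.swap.exists_delete_add_edge hmin hv hvB
    exact ⟨x, y, hx, hy, hxy, p, hpv, hyp, hxp, hlam.swap⟩
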